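/- Let S be a set of positive integers, let ε > 0, and define the coefficients c_{t,i} as in the context. For integers t > k ≥ 1, set a_{t,k} := Σ_{i=2}^{t−k+1} (1_{ℕ∖S}(i+k−1) − 1_{ℕ∖S}(i−1)) and b_{t,k} := #{2 ≤ i ≤ t−k+1 : 1_{ℕ∖S}(i+k−1) − 1_{ℕ∖S}(i−1) = −1}. Then the exact identity Σ_{i=1}^{t−k+1} c_{t,i} c_{t,i+1} ⋯ c_{t,i+k−1} = (1 + 1_{ℕ∖S}(k)·ε)·t + (t−k) + a_{t,k}·ε + b_{t,k}·ε²/(1+ε) holds, and moreover |a_{t,k}| ≤ 2k. -/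

import Mathlib

open Filter MeasureTheory Finset
open scoped Topology Classical

/-- A basic sequence: a sequence of integers, each at least `2`. -/
def IsBasic (q : ℕ → ℕ) : Prop := ∀ n, 2 ≤ q n

/-- The product `q_0 q_1 ⋯ q_{n-1}` of the first `n` terms of the basic sequence. -/
def qprod (q : ℕ → ℕ) (n : ℕ) : ℝ := ∏ i ∈ Finset.range n, (q i : ℝ)

/-- `T_{Q,n}(x) = (q_0 q_1 ⋯ q_{n-1}) x mod 1`. -/
noncomputable def TQ (q : ℕ → ℕ) (n : ℕ) (x : ℝ) : ℝ := Int.fract (qprod q n * x)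

/-- The `n`-th digit `E_n` of the `Q`-Cantor series expansion of `x`
(digit positions are indexed by `0, 1, 2, …`). -/
noncomputable def qdigit (q : ℕ → ℕ) (x : ℝ) (n : ℕ) : ℕ := ⌊(q n : ℝ) * TQ q n x⌋₊

/-- `N_n^Q(B,x)`: the number of occurrences of the block `B` starting among the first `n`
digit positions of the `Q`-Cantor series expansion of `x`. -/
noncomputable def blockCount (q : ℕ → ℕ) (x : ℝ) {k : ℕ} (B : Fin k → ℕ) (n : ℕ) : ℕ :=
  ((Finset.range n).filter fun i => ∀ j : Fin k, qdigit q x (i + (j : ℕ)) = B j).card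

/-- `Q_n^{(k)} = ∑_{j<n} 1/(q_j q_{j+1} ⋯ q_{j+k-1})`. -/
noncomputable def Qsum (q : ℕ → ℕ) (k n : ℕ) : ℝ :=
  ∑ j ∈ Finset.range n, (∏ i ∈ Finset.range k, (q (j + i) : ℝ))⁻¹

/-- `x` is `Q`-normal of order `k`: every block of length `k` occurs with the expected
asymptotic frequency. -/
def QNormalOfOrder (q : ℕ → ℕ) (k : ℕ) (x : ℝ) : Prop :=
  ∀ B : Fin k → ℕ,
    Tendsto (fun n => (blockCount q x B n : ℝ) / Qsum q k n) atTop (𝓝 1)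

/-- `x ∈ N(Q)`: `x` is `Q`-normal of every order `k ≥ 1`. -/
def QNormal (q : ℕ → ℕ) (x : ℝ) : Prop := ∀ k, 1 ≤ k → QNormalOfOrder q k x

/-- `Q` is fully divergent: `Q_n^{(k)} → ∞` for every `k ≥ 1`. -/
def FullyDivergent (q : ℕ → ℕ) : Prop :=
  ∀ k, 1 ≤ k → Tendsto (fun n => Qsum q k n) atTop atTop

/-- `Q` is infinite in limit: `q_n → ∞`. -/
def InfiniteInLimit (q : ℕ → ℕ) : Prop := Tendsto q atTop atTop

/-- `N_{n,m,r}^Q(B,x)`: occurrences of the block `B` (of length `m`) starting at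
positions `i < n` with `i ≡ r (mod m)`. -/
noncomputable def apCount (q : ℕ → ℕ) (x : ℝ) (m r : ℕ) (B : Fin m → ℕ) (n : ℕ) : ℕ :=
  ((Finset.range n).filter fun i =>
    i % m = r ∧ ∀ j : Fin m, qdigit q x (i + (j : ℕ)) = B j).card

/-- `Q_n^{(m,r)} = ∑_{j=0}^{⌊(n-r)/m⌋} 1/(q_{mj+r} q_{mj+r+1} ⋯ q_{mj+r+m-1})`. -/
noncomputable def apQsum (q : ℕ → ℕ) (m r n : ℕ) : ℝ :=
  ∑ j ∈ Finset.range ((n - r) / m + 1),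
    (∏ i ∈ Finset.range m, (q (m * j + r + i) : ℝ))⁻¹

/-- `x ∈ N^{I}_{m,r}(Q)`. -/
def MemNAPI (q : ℕ → ℕ) (m r : ℕ) (x : ℝ) : Prop :=
  ∀ B : Fin m → ℕ,
    Tendsto (fun n => (apCount q x m r B n : ℝ) / apQsum q m r n) atTop (𝓝 1)

/-- `x ∈ N^{I}_{Ab}(Q)`: `x` is AP `Q`-abnormal of type I. -/
def APAbnormalI (q : ℕ → ℕ) (x : ℝ) : Prop :=
  ∀ m, 2 ≤ m → ∀ r, r < m → ¬ MemNAPI q m r x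

/-- `x ∈ RN^{I}(Q)`. -/
def MemRNI (q : ℕ → ℕ) (x : ℝ) : Prop :=
  ∀ m, 1 ≤ m → ∀ r, r < m → ∀ B₁ B₂ : Fin m → ℕ,
    Tendsto (fun n => (apCount q x m r B₁ n : ℝ) / (apCount q x m r B₂ n : ℝ))
      atTop (𝓝 1)

/-- `Λ_{m,r}(Q) = (q_{mt+r})_t`. -/
def lamQ (q : ℕ → ℕ) (m r : ℕ) : ℕ → ℕ := fun t => q (m * t + r)

/-- `Υ_{Q,m,r}(x)`: the real number whose `Λ_{m,r}(Q)`-Cantor series digits are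
`(E_{mt+r})_t`, where `(E_n)` are the `Q`-Cantor series digits of `x`. -/
noncomputable def Ups (q : ℕ → ℕ) (m r : ℕ) (x : ℝ) : ℝ :=
  ∑' t : ℕ, (qdigit q x (m * t + r) : ℝ) / ∏ i ∈ Finset.range (t + 1), (lamQ q m r i : ℝ)

/-- `x ∈ N^{II}_{k,m,r}(Q) = Υ_{Q,m,r}^{-1}(N_k(Λ_{m,r}(Q)))`. -/
def MemNAPII (q : ℕ → ℕ) (k m r : ℕ) (x : ℝ) : Prop :=
  QNormalOfOrder (lamQ q m r) k (Ups q m r x)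

/-- `x ∈ N^{II}(Q)`: `x` is AP `Q`-normal of type II. -/
def APNormalII (q : ℕ → ℕ) (x : ℝ) : Prop :=
  ∀ k, 1 ≤ k → ∀ m, 1 ≤ m → ∀ r, r < m → MemNAPII q k m r x

/-- `x ∈ RN^{II}(Q)`: for all `k, m, r` the counts in `Υ_{Q,m,r}(x)` of any two blocks of
length `k` with respect to `Λ_{m,r}(Q)` have ratio tending to `1`. -/
def MemRNII (q : ℕ → ℕ) (x : ℝ) : Prop :=
  ∀ k, 1 ≤ k → ∀ m, 1 ≤ m → ∀ r, r < m → ∀ B₁ B₂ : Fin k → ℕ,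
    Tendsto (fun n =>
      (blockCount (lamQ q m r) (Ups q m r x) B₁ n : ℝ) /
      (blockCount (lamQ q m r) (Ups q m r x) B₂ n : ℝ)) atTop (𝓝 1)

/-- `S` (a set of positive integers) is almost closed under addition: for every `k ∈ S`,
the set `{x ∉ S : x + k ∈ S}` has asymptotic density `0`. -/
def AlmostClosed (S : Set ℕ) : Prop :=
  ∀ k ∈ S, Tendsto
    (fun t : ℕ => (((Finset.Icc 1 t).filter fun x => x ∉ S ∧ x + k ∈ S).card : ℝ) / t)
    atTop (𝓝 0)

/-- The sequence `u` of reals is uniformly distributed mod 1. -/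
def UDMod1 (u : ℕ → ℝ) : Prop :=
  ∀ a b : ℝ, 0 ≤ a → a < b → b ≤ 1 →
    Tendsto (fun N => (((Finset.range N).filter fun n => u n ∈ Set.Ico a b).card : ℝ) / N)
      atTop (𝓝 (b - a))

/-- `x ∈ DN(Q)`: `x` is `Q`-distribution normal. -/
def DistNormal (q : ℕ → ℕ) (x : ℝ) : Prop := UDMod1 fun n => TQ q n x

/-- `x ∈ DN_{Ab}(Q)`: `x` is AP `Q`-distribution abnormal. -/
def APDistAbnormal (q : ℕ → ℕ) (x : ℝ) : Prop :=
  ∀ m, 2 ≤ m → ∀ r, r < m → ¬ UDMod1 fun n => TQ q (m * n + r) x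

/-- `y ∈ D_{(x_n)}(Q)`: for every `ξ ∈ (0,1)`, the proportion of `n ≤ N` with
`fract (T_{Q,n}(y) - x_n) < ξ` tends to `1`. -/
def MemD (q : ℕ → ℕ) (xs : ℕ → ℝ) (y : ℝ) : Prop :=
  ∀ ξ : ℝ, 0 < ξ → ξ < 1 →
    Tendsto (fun N =>
      (((Finset.range N).filter fun n => Int.fract (TQ q n y - xs n) < ξ).card : ℝ) / N)
      atTop (𝓝 1)

/-- A computable real number. -/
def ComputableReal (x : ℝ) : Prop :=
  ∃ f : ℕ → ℕ, Computable f ∧ ∀ n : ℕ, 0 < n → (f n : ℝ) / n ≤ x ∧ x ≤ ((f n : ℝ) + 1) / n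

/-- The indicator function `1_{ℕ∖S}` of the complement of `S`, with values in `ℤ`. -/
noncomputable def indZ (S : Set ℕ) (i : ℕ) : ℤ := if i ∈ S then 0 else 1

/-- The indicator function `1_{ℕ∖S}` of the complement of `S`, with values in `ℝ`. -/
noncomputable def indR (S : Set ℕ) (i : ℕ) : ℝ := if i ∈ S then 0 else 1

/-- The coefficients `c_{t,i}`: `c_{t,1} = t (1+ε)^{1_{ℕ∖S}(1)}` and
`c_{t,i} = (1+ε)^{1_{ℕ∖S}(i) - 1_{ℕ∖S}(i-1)}` for `i ≥ 2`. -/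
noncomputable def coeff (S : Set ℕ) (ε : ℝ) (t i : ℕ) : ℝ :=
  if i = 1 then (t : ℝ) * (1 + ε) ^ indZ S 1
  else (1 + ε) ^ (indZ S i - indZ S (i - 1))

/-- `N_k(b)`: the set of real numbers normal of order `k` in base `b`. -/
def BaseNormalOfOrder (b k : ℕ) : Set ℝ :=
  {x | ∀ B : Fin k → ℕ, (∀ j, B j < b) →
    Tendsto (fun n => (blockCount (fun _ => b) x B n : ℝ) / n) atTop
      (𝓝 (((b : ℝ) ^ k)⁻¹))}

theorem indR_nonneg (S : Set ℕ) (i : ℕ) : 0 ≤ indR S i := by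
  unfold indR; split_ifs <;> norm_num

theorem indR_le_one (S : Set ℕ) (i : ℕ) : indR S i ≤ 1 := by
  unfold indR; split_ifs <;> norm_num

theorem coeff_one (S : Set ℕ) (ε : ℝ) (t : ℕ) :
    coeff S ε t 1 = t * (1 + ε) ^ indZ S 1 := by
  simp [coeff]

theorem coeff_succ (S : Set ℕ) (ε : ℝ) (t : ℕ) {i : ℕ} (hi : 1 ≤ i) :
    coeff S ε t (i + 1) = (1 + ε) ^ (indZ S (i + 1) - indZ S i) := by
  simp [coeff, show i ≠ 0 by omega]

/-- A block of consecutive coefficients that avoids `c_{t,1}` telescopes. -/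
theorem prod_coeff_succ (S : Set ℕ) {ε : ℝ} (hε : 0 < ε) (t : ℕ) {m : ℕ} (hm : 1 ≤ m)
    (k : ℕ) :
    ∏ j ∈ Finset.range k, coeff S ε t (m + 1 + j)
      = (1 + ε) ^ (indZ S (m + k) - indZ S m) := by
  have h0 : (1 + ε) ≠ 0 := by positivity
  induction k with
  | zero => simp
  | succ k ih =>
    rw [Finset.prod_range_succ, ih, show m + 1 + k = (m + k) + 1 by omega,
      coeff_succ S ε t (by omega), ← zpow_add₀ h0]
    congr 1
    rw [show m + (k + 1) = m + k + 1 by omega]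
    ring

/-- A block of consecutive coefficients that starts at `c_{t,1}` telescopes. -/
theorem prod_coeff_one (S : Set ℕ) {ε : ℝ} (hε : 0 < ε) (t k : ℕ) :
    ∏ j ∈ Finset.range (k + 1), coeff S ε t (1 + j) = t * (1 + ε) ^ indZ S (k + 1) := by
  have h0 : (1 + ε) ≠ 0 := by positivity
  rw [Finset.prod_range_succ']
  have h : ∏ j ∈ Finset.range k, coeff S ε t (1 + (j + 1))
      = (1 + ε) ^ (indZ S (1 + k) - indZ S 1) := by
    rw [← prod_coeff_succ S hε t le_rfl k]
    exact Finset.prod_congr rfl fun j _ => by rw [add_comm j 1, add_assoc]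
  rw [h, add_zero, coeff_one]
  rw [mul_left_comm, ← zpow_add₀ h0, add_comm 1 k]
  congr 2
  ring

theorem zpow_indZ (S : Set ℕ) (ε : ℝ) (i : ℕ) :
    (1 + ε) ^ indZ S i = 1 + indR S i * ε := by
  unfold indZ indR; split_ifs <;> simp

theorem zpow_indZ_sub (S : Set ℕ) {ε : ℝ} (hε : 0 < ε) (i j : ℕ) :
    (1 + ε) ^ (indZ S i - indZ S j) = 1 + (indR S i - indR S j) * ε
      + (if indR S i - indR S j = -1 then 1 else 0) * (ε ^ 2 / (1 + ε)) := by
  have h0 : (1 + ε) ≠ 0 := by positivity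
  unfold indZ indR
  split_ifs <;> norm_num at *
  field_simp
  ring

/-- The shift by `k` of a `[0,1]`-valued sequence changes its sums over intervals by at most
`k`. -/
theorem abs_sum_shift_sub_le {f : ℕ → ℝ} (h0 : ∀ i, 0 ≤ f i) (h1 : ∀ i, f i ≤ 1) (n k : ℕ) :
    |∑ m ∈ Finset.range n, (f (m + k) - f m)| ≤ k := by
  induction k with
  | zero => simp
  | succ k ih =>
    have h : ∑ m ∈ Finset.range n, (f (m + (k + 1)) - f m)
        = (f (n + k) - f k) + ∑ m ∈ Finset.range n, (f (m + k) - f m) := by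
      have ht := Finset.sum_range_sub (fun m => f (m + k)) n
      rw [zero_add] at ht
      rw [← ht, ← Finset.sum_add_distrib]
      refine Finset.sum_congr rfl fun m _ => ?_
      rw [show m + (k + 1) = m + 1 + k by omega]
      ring
    rw [h, abs_le]
    rw [abs_le] at ih
    push_cast
    constructor <;> linarith [h0 (n + k), h1 (n + k), h0 k, h1 k, ih.1, ih.2]

/-- For any set `S` of positive integers, `ε > 0` and `t > k ≥ 1`, with
`a_{t,k} = ∑_{i=2}^{t-k+1} (1_{ℕ∖S}(i+k-1) - 1_{ℕ∖S}(i-1))` and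
`b_{t,k} = #{2 ≤ i ≤ t-k+1 : 1_{ℕ∖S}(i+k-1) - 1_{ℕ∖S}(i-1) = -1}`, we have the exact
identity
`∑_{i=1}^{t-k+1} c_{t,i} ⋯ c_{t,i+k-1}
  = (1 + 1_{ℕ∖S}(k) ε) t + (t-k) + a_{t,k} ε + b_{t,k} ε²/(1+ε)`,
and `|a_{t,k}| ≤ 2k`. -/
theorem stmt12 (S : Set ℕ) (hSpos : 0 ∉ S) (ε : ℝ) (hε : 0 < ε)
    (t k : ℕ) (hk : 1 ≤ k) (htk : k < t) :
    (∑ i ∈ Finset.Icc 1 (t - k + 1), ∏ j ∈ Finset.range k, coeff S ε t (i + j))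
      = (1 + indR S k * ε) * (t : ℝ) + ((t : ℝ) - (k : ℝ))
        + (∑ i ∈ Finset.Icc 2 (t - k + 1), (indR S (i + k - 1) - indR S (i - 1))) * ε
        + (((Finset.Icc 2 (t - k + 1)).filter
            (fun i => indR S (i + k - 1) - indR S (i - 1) = -1)).card : ℝ)
          * ε ^ 2 / (1 + ε) ∧
    |∑ i ∈ Finset.Icc 2 (t - k + 1), (indR S (i + k - 1) - indR S (i - 1))|
      ≤ 2 * (k : ℝ) := by
  constructor
  · have hblock : ∀ i ∈ Finset.Icc 2 (t - k + 1),
        ∏ j ∈ Finset.range k, coeff S ε t (i + j)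
          = 1 + (indR S (i + k - 1) - indR S (i - 1)) * ε
            + (if indR S (i + k - 1) - indR S (i - 1) = -1 then 1 else 0)
              * (ε ^ 2 / (1 + ε)) := by
      intro i hi
      obtain ⟨m, rfl⟩ : ∃ m, i = m + 1 := ⟨i - 1, by grind⟩
      have hm : 1 ≤ m := by grind
      rw [prod_coeff_succ S hε t hm, zpow_indZ_sub S hε,
        show m + 1 + k - 1 = m + k by omega, Nat.add_sub_cancel]
    have hfirst : ∏ j ∈ Finset.range k, coeff S ε t (1 + j) = t * (1 + indR S k * ε) := by
      obtain ⟨l, rfl⟩ : ∃ l, k = l + 1 := ⟨k - 1, by omega⟩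
      rw [prod_coeff_one S hε, zpow_indZ]
    have hcard : ((t - k + 1 + 1 - 2 : ℕ) : ℝ) = t - k := by
      rw [show t - k + 1 + 1 - 2 = t - k by omega, Nat.cast_sub htk.le]
    rw [← Finset.add_sum_Ioc_eq_sum_Icc (by omega : 1 ≤ t - k + 1), hfirst,
      show Finset.Ioc 1 (t - k + 1) = Finset.Icc 2 (t - k + 1) by ext; simp; omega,
      Finset.sum_congr rfl hblock, Finset.sum_add_distrib, Finset.sum_add_distrib,
      ← Finset.sum_mul, ← Finset.sum_mul, Finset.sum_boole, Finset.sum_const,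
      Nat.card_Icc, nsmul_eq_mul, mul_one, hcard]
    ring
  · have hshift : ∑ i ∈ Finset.Icc 2 (t - k + 1), (indR S (i + k - 1) - indR S (i - 1))
        = ∑ m ∈ Finset.range (t - k), (indR S (m + k + 1) - indR S (m + 1)) := by
      rw [show Finset.Icc 2 (t - k + 1) = Finset.Ico 2 (t - k + 2) by ext; simp; omega,
        Finset.sum_Ico_eq_sum_range, Nat.add_sub_cancel]
      refine Finset.sum_congr rfl fun m _ => ?_
      rw [show 2 + m + k - 1 = m + k + 1 by omega, show 2 + m - 1 = m + 1 by omega]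
    rw [hshift]
    have h := abs_sum_shift_sub_le (f := fun i => indR S (i + 1))
      (fun i => indR_nonneg S _) (fun i => indR_le_one S _) (t - k) k
    have hk0 : (0 : ℝ) ≤ k := k.cast_nonneg
    linarith
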